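/- Assume A ∥_M B, A ∥_M A and B ∥_M B. If a_{k+1} ≡_Π b_{l+1} and n and m are both even, then M : a_{k+1}−b_{l+1}−a_{k+n} if and only if M : a_{k+1}−b_{l+m}−a_{k+n}. -/

import Mathlib

/-- `x` precedes `y` in the list `M` (`x <_M y`). -/
def ltL (M : List ℕ) (x y : ℕ) : Prop :=
  ∃ i j : ℕ, i < j ∧ M[i]? = some x ∧ M[j]? = some y

/-- `M : x−y−z`: the distinct members `x`, `y`, `z` occur in `M` in that order
or in the reverse order. -/
def BtwL (M : List ℕ) (x y z : ℕ) : Prop :=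
  (ltL M x y ∧ ltL M y z) ∨ (ltL M z y ∧ ltL M y x)

/-- `x` and `y` are `L`-neighbours: one is the immediate predecessor of the
other in `L`. -/
def Neighb (L : List ℕ) (x y : ℕ) : Prop :=
  ∃ i : ℕ, (L[i]? = some x ∧ L[i + 1]? = some y) ∨ (L[i]? = some y ∧ L[i + 1]? = some x)

/-- The immediate successor of `v` in the list `F` (if it exists). -/
def succIn (F : List ℕ) (v : ℕ) : Option ℕ :=
  if v ∈ F then F[F.idxOf v + 1]? else none

/-- The immediate predecessor of `v` in the list `F` (if it exists). -/
def predIn (F : List ℕ) (v : ℕ) : Option ℕ :=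
  if v ∈ F ∧ F.idxOf v ≠ 0 then F[F.idxOf v - 1]? else none

/-- `u` and `v` are of the same parity: their indices (given by `idx`) are both
even or both odd. -/
def SameParity (idx : ℕ → ℕ) (u v : ℕ) : Prop := idx u % 2 = idx v % 2

/-- `M[v, u, vˢ]`: the member `u` (whose own list is `Fu`) is interlaced in `M`
with `v` and its immediate successor `vˢ` in the list `Fv`. -/
def Interlaced (M : List ℕ) (idx : ℕ → ℕ) (Fu Fv : List ℕ) (u v : ℕ) : Prop :=
  u ≠ v ∧ ∃ vs, succIn Fv v = some vs ∧ BtwL M v u vs ∧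
    (SameParity idx u vs → ∀ up, predIn Fu u = some up → ¬ BtwL M v up vs) ∧
    (SameParity idx u v → ∀ us, succIn Fu u = some us → ¬ BtwL M v us vs)

/-- `F ∥_M G`: no member of `F` is interlaced in `M` with two successive members
of `G`, and no member of `G` is interlaced in `M` with two successive members
of `F`. -/
def Parallel (M : List ℕ) (idx : ℕ → ℕ) (F G : List ℕ) : Prop :=
  (∀ u ∈ F, ∀ v ∈ G, ¬ Interlaced M idx F G u v) ∧
  (∀ u ∈ G, ∀ v ∈ F, ¬ Interlaced M idx G F u v)

theorem sumEven (f : ℕ → ZMod 2) (N : ℕ) :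
    ∑ i ∈ Finset.range (2*N), f i = ∑ i ∈ Finset.range N, (f (2*i) + f (2*i+1)) := by
  induction N with
  | zero => simp
  | succ N ih =>
    rw [show 2*(N+1) = 2*N+1+1 by ring, Finset.sum_range_succ, Finset.sum_range_succ, ih,
      Finset.sum_range_succ]; ring

theorem sumOdd (f : ℕ → ZMod 2) (N : ℕ) :
    ∑ i ∈ Finset.range (2*N+2), f i
      = f 0 + f (2*N+1) + ∑ i ∈ Finset.range N, (f (2*i+1) + f (2*i+2)) := by
  induction N with
  | zero => simp [Finset.sum_range_succ]
  | succ N ih =>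
    rw [show 2*(N+1)+2 = 2*N+2+1+1 by ring, Finset.sum_range_succ, Finset.sum_range_succ, ih,
      Finset.sum_range_succ]; ring_nf

theorem z2 (a b c d : ZMod 2) (h : (a ≠ b → c ≠ d)) (h' : (c ≠ d → a ≠ b)) :
    a + c = b + d := by
  revert a b c d; decide

theorem core (s : ℕ → ℕ → ZMod 2) (N m : ℕ) (hm : m % 2 = 0) (hm1 : 1 ≤ m)
    (h1 : ∀ i j, i < 2*N+2 → j + 1 < m → s i j ≠ s i (j+1) →
      (i % 2 = j % 2 → i + 1 < 2*N+2 ∧ s (i+1) j ≠ s (i+1) (j+1)) ∧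
      (i % 2 ≠ j % 2 → 1 ≤ i ∧ s (i-1) j ≠ s (i-1) (j+1)))
    (h2 : ∀ i j, i + 1 < 2*N+2 → j < m → s i j ≠ s (i+1) j →
      (i % 2 = j % 2 → j + 1 < m) ∧ (i % 2 ≠ j % 2 → 1 ≤ j)) :
    s 0 0 + s (2*N+1) 0 = s 0 (m-1) + s (2*N+1) (m-1) := by
  have step : ∀ j, j + 1 < m → ∑ i ∈ Finset.range (2*N+2), s i j
      = ∑ i ∈ Finset.range (2*N+2), s i (j+1) := by
    intro j hj
    rcases Nat.mod_two_eq_zero_or_one j with hp | hp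
    · rw [show 2*N+2 = 2*(N+1) by ring, sumEven, sumEven]
      apply Finset.sum_congr rfl
      intro i hi
      have hi := Finset.mem_range.1 hi
      apply z2
      · intro h; exact ((h1 _ _ (by omega) hj h).1 (by omega)).2
      · intro h; exact ((h1 _ _ (by omega) hj h).2 (by omega)).2
    · rw [sumOdd, sumOdd]
      congr 1
      · congr 1
        · by_contra h
          have := ((h1 _ _ (by omega) hj h).2 (by omega)).1
          omega
        · by_contra h
          have := ((h1 _ _ (by omega) hj h).1 (by omega)).1
          omega
      · apply Finset.sum_congr rfl
        intro i hi
        have hi := Finset.mem_range.1 hi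
        apply z2
        · intro h; exact ((h1 _ _ (by omega) hj h).1 (by omega)).2
        · intro h; exact ((h1 _ _ (by omega) hj h).2 (by omega)).2
  have all : ∀ j, j < m → ∑ i ∈ Finset.range (2*N+2), s i 0
      = ∑ i ∈ Finset.range (2*N+2), s i j := by
    intro j
    induction j with
    | zero => intro _; rfl
    | succ j ih => intro hj; rw [ih (by omega), step j hj]
  have hend : ∀ j, j < m → (j = 0 ∨ j = m - 1) → ∑ i ∈ Finset.range (2*N+2), s i j
      = s 0 j + s (2*N+1) j := by
    intro j hj hj'
    rw [sumOdd, Finset.sum_eq_zero, add_zero]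
    intro i hi
    have hi := Finset.mem_range.1 hi
    have : s (2*i+1) j = s (2*i+2) j := by
      by_contra h
      have := h2 _ _ (by omega) hj h
      omega
    rw [this]; exact CharTwo.add_self_eq_zero _
  rw [← hend 0 (by omega) (Or.inl rfl), ← hend (m-1) (by omega) (Or.inr rfl)]
  exact all _ (by omega)

theorem ltL_iff {M : List ℕ} (hM : M.Nodup) {x y : ℕ} (hx : x ∈ M) (hy : y ∈ M) :
    ltL M x y ↔ M.idxOf x < M.idxOf y := by
  constructor
  · rintro ⟨i, j, hij, h1, h2⟩
    obtain ⟨hi, rfl⟩ := List.getElem?_eq_some_iff.1 h1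
    obtain ⟨hj, rfl⟩ := List.getElem?_eq_some_iff.1 h2
    rw [hM.idxOf_getElem, hM.idxOf_getElem]; exact hij
  · intro h
    exact ⟨_, _, h, by simp [hx], by simp [hy]⟩

theorem btwL_iff_idx {M : List ℕ} (hM : M.Nodup) {x y z : ℕ} (hx : x ∈ M) (hy : y ∈ M) (hz : z ∈ M)
    (hxy : x ≠ y) (hzy : z ≠ y) :
    BtwL M x y z ↔ ¬ (M.idxOf x < M.idxOf y ↔ M.idxOf z < M.idxOf y) := by
  have h1 : M.idxOf x ≠ M.idxOf y := fun h => hxy ((List.idxOf_inj hx).1 h)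
  have h2 : M.idxOf z ≠ M.idxOf y := fun h => hzy ((List.idxOf_inj hz).1 h)
  unfold BtwL
  rw [ltL_iff hM hx hy, ltL_iff hM hy hz, ltL_iff hM hz hy, ltL_iff hM hy hx]
  omega

theorem par_step {M F G : List ℕ} {idx : ℕ → ℕ} (hF : F.Nodup) (hG : G.Nodup)
    (h : ∀ u ∈ F, ∀ v ∈ G, ¬ Interlaced M idx F G u v) {i j : ℕ}
    (hi : i < F.length) (hj : j + 1 < G.length) (hne : F[i] ≠ G[j])
    (hpar : idx G[j] % 2 ≠ idx G[j+1] % 2)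
    (hb : BtwL M G[j] F[i] G[j+1]) :
    (idx F[i] % 2 = idx G[j] % 2 → ∃ h : i + 1 < F.length, BtwL M G[j] F[i+1] G[j+1]) ∧
    (idx F[i] % 2 ≠ idx G[j] % 2 → ∃ h : 1 ≤ i, BtwL M G[j] F[i-1] G[j+1]) := by
  have hs : succIn G G[j] = some G[j+1] := by
    simp [succIn, hG.idxOf_getElem, hj]
  have h := h F[i] (List.getElem_mem _) G[j] (List.getElem_mem _)
  constructor
  · intro hp
    by_contra hc
    apply h
    refine ⟨hne, _, hs, hb, fun hq => ?_, fun _ us hus hbt => hc ?_⟩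
    · unfold SameParity at hq; omega
    · simp only [succIn, List.getElem_mem, if_true, hF.idxOf_getElem] at hus
      obtain ⟨h1, rfl⟩ := List.getElem?_eq_some_iff.1 hus
      exact ⟨h1, hbt⟩
  · intro hp
    by_contra hc
    apply h
    refine ⟨hne, _, hs, hb, fun _ up hup hbt => hc ?_, fun hq => ?_⟩
    · simp only [predIn, List.getElem_mem, true_and, hF.idxOf_getElem] at hup
      split_ifs at hup with h0
      obtain ⟨h1, rfl⟩ := List.getElem?_eq_some_iff.1 hup
      exact ⟨by omega, hbt⟩
    · unfold SameParity at hq; omega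

/-- **Lemma 2.1.6**: assuming `A ∥_M B`, `A ∥_M A` and `B ∥_M B`, if
`a_{k+1} ≡_Π b_{l+1}` and `n` and `m` are both even, then
`M : a_{k+1}−b_{l+1}−a_{k+n}` iff `M : a_{k+1}−b_{l+m}−a_{k+n}`. -/
theorem btw_first_iff_btw_last (A B M : List ℕ) (k l n m : ℕ) (idx : ℕ → ℕ)
    (hAlen : A.length = n) (hBlen : B.length = m) (hn : 1 ≤ n) (hm : 1 ≤ m)
    (hAnd : A.Nodup) (hBnd : B.Nodup) (hAB : A.Disjoint B)
    (hMnd : M.Nodup) (hM : ∀ x, x ∈ M ↔ x ∈ A ∨ x ∈ B)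
    (hiA : ∀ (i x : ℕ), A[i]? = some x → idx x = k + 1 + i)
    (hiB : ∀ (j x : ℕ), B[j]? = some x → idx x = l + 1 + j)
    (hAB' : Parallel M idx A B) (hAA : Parallel M idx A A) (hBB : Parallel M idx B B)
    (a₁ aₙ b₁ bₘ : ℕ)
    (ha₁ : A[0]? = some a₁) (haₙ : A[n - 1]? = some aₙ)
    (hb₁ : B[0]? = some b₁) (hbₘ : B[m - 1]? = some bₘ)
    (hpar : SameParity idx a₁ b₁)
    (hneven : n % 2 = 0) (hmeven : m % 2 = 0) :
    BtwL M a₁ b₁ aₙ ↔ BtwL M a₁ bₘ aₙ := by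
  obtain ⟨N, rfl⟩ : ∃ N, n = 2*N+2 := ⟨n/2-1, by omega⟩
  have memA : ∀ i (h : i < A.length), A[i] ∈ M := fun i h => (hM _).2 (Or.inl (List.getElem_mem h))
  have memB : ∀ i (h : i < B.length), B[i] ∈ M := fun i h => (hM _).2 (Or.inr (List.getElem_mem h))
  have hne : ∀ i j (h : i < A.length) (h' : j < B.length), A[i] ≠ B[j] := by
    intro i j h h' he
    exact hAB (List.getElem_mem h) (he ▸ List.getElem_mem h')
  have idA : ∀ i (h : i < A.length), idx A[i] = k + 1 + i := fun i h => hiA i _ (by simp [h])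
  have idB : ∀ i (h : i < B.length), idx B[i] = l + 1 + i := fun i h => hiB i _ (by simp [h])
  obtain ⟨hl1, rfl⟩ := List.getElem?_eq_some_iff.1 ha₁
  obtain ⟨hl2, rfl⟩ := List.getElem?_eq_some_iff.1 haₙ
  obtain ⟨hl3, rfl⟩ := List.getElem?_eq_some_iff.1 hb₁
  obtain ⟨hl4, rfl⟩ := List.getElem?_eq_some_iff.1 hbₘ
  have hkl : (k + 1) % 2 = (l + 1) % 2 := by
    have := hpar
    unfold SameParity at this
    rw [idA, idB] at this
    simpa using this
  let s : ℕ → ℕ → ZMod 2 := fun i j =>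
    if M.idxOf (A.getD i 0) < M.idxOf (B.getD j 0) then 1 else 0
  have hs : ∀ i j (h : i < A.length) (h' : j < B.length),
      s i j = if M.idxOf A[i] < M.idxOf B[j] then 1 else 0 := by
    intro i j h h'
    simp [s, h, h']
  have pne : ∀ i j (h : i < A.length) (h' : j < B.length), M.idxOf A[i] ≠ M.idxOf B[j] :=
    fun i j h h' he => hne i j h h' ((List.idxOf_inj (memA i h)).1 he)
  have sA : ∀ i i' j (h : i < A.length) (h1 : i' < A.length) (h' : j < B.length),
      BtwL M A[i] B[j] A[i'] ↔ s i j ≠ s i' j := by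
    intro i i' j h h1 h'
    rw [btwL_iff_idx hMnd (memA _ h) (memB _ h') (memA _ h1) (hne _ _ _ _) (hne _ _ _ _),
      hs _ _ h h', hs _ _ h1 h']
    split_ifs <;> simp <;> omega
  have sB : ∀ i j j' (h : i < A.length) (h1 : j < B.length) (h' : j' < B.length),
      BtwL M B[j] A[i] B[j'] ↔ s i j ≠ s i j' := by
    intro i j j' h h1 h'
    rw [btwL_iff_idx hMnd (memB _ h1) (memA _ h) (memB _ h') (hne _ _ _ _).symm (hne _ _ _ _).symm,
      hs _ _ h h1, hs _ _ h h']
    have := pne i j h h1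
    have := pne i j' h h'
    split_ifs <;> simp <;> omega
  have key := core s N m hmeven hm ?_ ?_
  · rw [sA, sA]
    simp only [show 2 * N + 2 - 1 = 2*N+1 by omega]
    generalize s 0 0 = a at *
    generalize s (2*N+1) 0 = b at *
    generalize s 0 (m-1) = c at *
    generalize s (2*N+1) (m-1) = d at *
    clear * - key
    revert a b c d; decide
  · intro i j hi hj h
    rw [← hAlen] at hi
    rw [← hBlen] at hj
    have := par_step (idx := idx) hAnd hBnd hAB'.1 hi hj (hne _ _ _ _)
      (by rw [idB, idB]; omega) ((sB _ _ _ _ _ _).2 h)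
    rw [idA, idB] at this
    refine ⟨fun hp => ?_, fun hp => ?_⟩
    · obtain ⟨h1, h2⟩ := this.1 (by omega)
      exact ⟨by omega, (sB _ _ _ _ _ _).1 h2⟩
    · obtain ⟨h1, h2⟩ := this.2 (by omega)
      exact ⟨by omega, (sB _ _ _ _ _ _).1 h2⟩
  · intro i j hi hj h
    rw [← hAlen] at hi
    rw [← hBlen] at hj
    have := par_step (idx := idx) hBnd hAnd hAB'.2 hj hi (hne _ _ _ _).symm
      (by rw [idA, idA]; omega) ((sA _ _ _ _ _ _).2 h)
    rw [idA, idB] at this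
    refine ⟨fun hp => ?_, fun hp => ?_⟩
    · obtain ⟨h1, h2⟩ := this.1 (by omega)
      omega
    · obtain ⟨h1, h2⟩ := this.2 (by omega)
      omega
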